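/- For every natural number ℓ ≥ 1 and every pair of neighboring datasets D and D' (i.e., D' is obtained from D by removing exactly one entry), the greedy estimates satisfy |D̂_ℓ(D) − D̂_ℓ(D')| ≤ ℓ. -/

import Mathlib

/-- The one-person greedy step: `g(u, S) = S ∪ {min (u \ S)}` if `u \ S ≠ ∅`,
and `g(u, S) = S` otherwise. -/
def gstep {Ω : Type*} [LinearOrder Ω] (u S : Finset Ω) : Finset Ω :=
  if h : (u \ S).Nonempty then insert ((u \ S).min' h) S else S

/-- One greedy pass over the dataset `D = (u_1, …, u_n)`:
`S ↦ g(u_n, g(u_{n−1}, …, g(u_1, S)…))`. -/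
def greedyPass {Ω : Type*} [LinearOrder Ω] (D : List (Finset Ω)) (S : Finset Ω) :
    Finset Ω :=
  D.foldl (fun T u => gstep u T) S

/-- The greedy estimate `D̂_ℓ(D)`: the cardinality of the set obtained by applying
the greedy pass over `D` exactly `ℓ` times, starting from the empty set. -/
def greedyEst {Ω : Type*} [LinearOrder Ω] (D : List (Finset Ω)) (ℓ : ℕ) : ℕ :=
  ((greedyPass D)^[ℓ] ∅).card

section GreedyHelpers

variable {Ω : Type*} [LinearOrder Ω]

theorem subset_gstep (u S : Finset Ω) : S ⊆ gstep u S := by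
  unfold gstep
  split_ifs with h
  · exact Finset.subset_insert _ _
  · exact Finset.Subset.refl _

theorem card_gstep (u S : Finset Ω) :
    (gstep u S).card = S.card + if (u \ S).Nonempty then 1 else 0 := by
  unfold gstep
  split_ifs with h
  · exact Finset.card_insert_of_notMem (Finset.mem_sdiff.1 (Finset.min'_mem _ h)).2
  · rfl

theorem gstep_mono (u : Finset Ω) : Monotone (gstep u) := by
  intro S T hST
  by_cases h : (u \ S).Nonempty
  · have hS : gstep u S = insert ((u \ S).min' h) S := dif_pos h
    rw [hS]
    refine Finset.insert_subset ?_ (hST.trans (subset_gstep u T))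
    by_cases hx : (u \ S).min' h ∈ T
    · exact subset_gstep u T hx
    · have hmem : (u \ S).min' h ∈ u \ T :=
        Finset.mem_sdiff.2 ⟨(Finset.mem_sdiff.1 (Finset.min'_mem _ h)).1, hx⟩
      have hT : gstep u T = insert ((u \ T).min' ⟨_, hmem⟩) T := dif_pos ⟨_, hmem⟩
      have heq : (u \ S).min' h = (u \ T).min' ⟨_, hmem⟩ :=
        le_antisymm (Finset.min'_subset _ (Finset.sdiff_subset_sdiff le_rfl hST))
          (Finset.min'_le _ _ hmem)
      exact hT ▸ Finset.mem_insert.2 (Or.inl heq)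
  · have hS : gstep u S = S := dif_neg h
    rw [hS]
    exact hST.trans (subset_gstep u T)

/-- `T` contains `S` and has at most `k` further elements. -/
def IsSupersetWithin (k : ℕ) (S T : Finset Ω) : Prop :=
  S ⊆ T ∧ T.card ≤ S.card + k

theorem IsSupersetWithin.gstep {k : ℕ} {S T : Finset Ω} (h : IsSupersetWithin k S T)
    (u : Finset Ω) : IsSupersetWithin k (gstep u S) (gstep u T) := by
  refine ⟨gstep_mono u h.1, ?_⟩
  have hcard := h.2
  have hne : (u \ T).Nonempty → (u \ S).Nonempty :=
    fun hT => hT.mono (Finset.sdiff_subset_sdiff le_rfl h.1)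
  rw [card_gstep, card_gstep]
  split_ifs <;> first | omega | (exfalso; tauto)

theorem IsSupersetWithin.gstep_right {k : ℕ} {S T : Finset Ω} (h : IsSupersetWithin k S T)
    (u : Finset Ω) : IsSupersetWithin (k + 1) S (_root_.gstep u T) := by
  refine ⟨h.1.trans (subset_gstep u T), ?_⟩
  have hcard := h.2
  rw [card_gstep]
  split_ifs <;> omega

theorem IsSupersetWithin.greedyPass {k : ℕ} (D : List (Finset Ω)) {S T : Finset Ω}
    (h : IsSupersetWithin k S T) :
    IsSupersetWithin k (greedyPass D S) (greedyPass D T) := by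
  induction D generalizing S T with
  | nil => exact h
  | cons u D ih => exact ih (h.gstep u)

theorem IsSupersetWithin.greedyPass_eraseIdx {k : ℕ} (D : List (Finset Ω)) {j : ℕ}
    (hj : j < D.length) {S T : Finset Ω} (h : IsSupersetWithin k S T) :
    IsSupersetWithin (k + 1) (_root_.greedyPass (D.eraseIdx j) S) (_root_.greedyPass D T) := by
  induction D generalizing S T j with
  | nil => exact absurd hj (Nat.not_lt_zero j)
  | cons u D ih =>
    cases j with
    | zero => exact (h.gstep_right u).greedyPass D
    | succ j => exact ih (Nat.lt_of_succ_lt_succ hj) (h.gstep u)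

theorem isSupersetWithin_iterate_greedyPass_eraseIdx (D : List (Finset Ω)) {j : ℕ}
    (hj : j < D.length) (ℓ : ℕ) :
    IsSupersetWithin ℓ ((greedyPass (D.eraseIdx j))^[ℓ] ∅) ((greedyPass D)^[ℓ] ∅) := by
  induction ℓ with
  | zero => exact ⟨Finset.Subset.refl _, le_rfl⟩
  | succ ℓ ih =>
    rw [Function.iterate_succ_apply', Function.iterate_succ_apply']
    exact ih.greedyPass_eraseIdx D hj

end GreedyHelpers

/-- Sensitivity of the greedy estimate: for `ℓ ≥ 1` and neighboring datasets `D`, `D'`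
(`D'` is `D` with one entry removed), `|D̂_ℓ(D) − D̂_ℓ(D')| ≤ ℓ`. -/
theorem greedyEst_sensitivity {Ω : Type*} [LinearOrder Ω]
    (ℓ : ℕ) (hℓ : 1 ≤ ℓ) (D D' : List (Finset Ω))
    (hneighbor : ∃ j, j < D.length ∧ D' = D.eraseIdx j) :
    |(greedyEst D ℓ : ℤ) - (greedyEst D' ℓ : ℤ)| ≤ (ℓ : ℤ) := by
  obtain ⟨j, hj, rfl⟩ := hneighbor
  obtain ⟨hsub, hcard⟩ := isSupersetWithin_iterate_greedyPass_eraseIdx D hj ℓ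
  have hle := Finset.card_le_card hsub
  unfold greedyEst
  rw [abs_le]
  omega
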